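/- arXiv:2402.13971 — 4 statements merged into one kernel-verified Lean document; each statement's English description precedes it below -/
import Mathlib

section
/- The exact solution of a one-dimensional ODE is given by a multi-indice B-series. Let f : ℝ → ℝ be C^∞, y_0 ∈ ℝ, ε > 0, and let y : (−ε, ε) → ℝ be differentiable with y(0) = y_0 and y'(h) = f(y(h)) for all h ∈ (−ε, ε) (such y is automatically C^∞). Let a be a real-valued map on populated multi-indices satisfying, for every populated β, the recursion |β| · a(β) = ∑_{k ∈ ℕ} ∑_{(β_1, …, β_k)} ∏_{i=1}^{k} a(β_i), where the inner sum runs over ordered k-tuples of populated multi-indices with δ_k + β_1 + ⋯ + β_k = β (only finitely many summands are nonzero; the recursion forces a(δ_0) = 1). Then for every n ≥ 1, the n-th derivative of y at 0 equals n! · ∑_{β populated, |β| = n} (a(β)/S(β)) · ∏_k (f^{(k)}(y_0))^{β(k)}, a finite sum. -/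
open scoped Classical

/-- Multi-indices: finitely supported functions `ℕ → ℕ`. -/
abbrev MI := ℕ →₀ ℕ

/-- `β` is populated if `∑_k (1 - k) β(k) = 1`. -/
def Populated (β : MI) : Prop := (β.sum fun k n => (1 - (k : ℤ)) * n) = 1

/-- The length `|β| = ∑_k β(k)`. -/
def len (β : MI) : ℕ := β.sum fun _ n => n

/-- The symmetry factor `S(β) = ∏_k (k!)^{β k}`. -/
noncomputable def S (β : MI) : ℝ := β.prod fun k n => (k.factorial : ℝ) ^ n


section TaylorPowerSeries

open PowerSeries Filter Topology

/-- The formal Taylor series of `g` at `x`, in the displacement from `x`. -/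
noncomputable def taylorPowerSeries (g : ℝ → ℝ) (x : ℝ) : PowerSeries ℝ :=
  PowerSeries.mk fun n => iteratedDeriv n g x / (n.factorial : ℝ)

lemma coeff_taylorPowerSeries (g : ℝ → ℝ) (x : ℝ) (n : ℕ) :
    coeff n (taylorPowerSeries g x) = iteratedDeriv n g x / (n.factorial : ℝ) := by
  simp [taylorPowerSeries]

lemma derivative_taylorPowerSeries (g : ℝ → ℝ) (x : ℝ) :
    derivative ℝ (taylorPowerSeries g x) = taylorPowerSeries (deriv g) x := by
  ext n
  rw [coeff_derivative, coeff_taylorPowerSeries, coeff_taylorPowerSeries, iteratedDeriv_succ',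
    Nat.factorial_succ]
  have : (n.factorial : ℝ) ≠ 0 := by positivity
  push_cast
  field_simp

lemma taylorPowerSeries_congr {g h : ℝ → ℝ} {x : ℝ} (hgh : g =ᶠ[𝓝 x] h) :
    taylorPowerSeries g x = taylorPowerSeries h x := by
  ext n
  rw [coeff_taylorPowerSeries, coeff_taylorPowerSeries, hgh.iteratedDeriv_eq]

lemma taylorPowerSeries_mul {g h : ℝ → ℝ} {x : ℝ} (hg : ContDiffAt ℝ (⊤ : ℕ∞) g x)
    (hh : ContDiffAt ℝ (⊤ : ℕ∞) h x) :
    taylorPowerSeries (g * h) x = taylorPowerSeries g x * taylorPowerSeries h x := by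
  ext n
  rw [coeff_mul, coeff_taylorPowerSeries,
    iteratedDeriv_mul (hg.of_le (by exact_mod_cast le_top)) (hh.of_le (by exact_mod_cast le_top)),
    Finset.Nat.sum_antidiagonal_eq_sum_range_succ_mk, Finset.sum_div]
  refine Finset.sum_congr rfl fun i hi => ?_
  rw [coeff_taylorPowerSeries, coeff_taylorPowerSeries,
    Nat.cast_choose ℝ (Nat.lt_succ_iff.mp (Finset.mem_range.mp hi))]
  have h1 : (n.factorial : ℝ) ≠ 0 := by positivity
  field_simp

/-- The formal Taylor series of a composition is the substitution of the formal Taylor series. -/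
lemma taylorPowerSeries_comp {y : ℝ → ℝ} {x : ℝ} (hy : ContDiffAt ℝ (⊤ : ℕ∞) y x)
    {g : ℝ → ℝ} (hg : ContDiff ℝ (⊤ : ℕ∞) g) :
    taylorPowerSeries (g ∘ y) x =
      (taylorPowerSeries g (y x)).subst (taylorPowerSeries y x - C (y x)) := by
  set u := taylorPowerSeries y x - C (y x) with hu
  have hu0 : constantCoeff u = 0 := by
    rw [← coeff_zero_eq_constantCoeff_apply, hu, map_sub, coeff_taylorPowerSeries]
    simp
  have hus : HasSubst u := HasSubst.of_constantCoeff_zero' hu0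
  ext m
  induction m using Nat.strong_induction_on generalizing g with
  | _ m ih =>
    rcases m with _ | m
    · rw [coeff_subst' hus, finsum_eq_single _ 0]
      · simp [coeff_taylorPowerSeries]
      · intro d hd
        simp [hu0, hd]
    · have hg' : ContDiff ℝ (⊤ : ℕ∞) (deriv g) := (contDiff_infty_iff_deriv.mp hg).2
      have hy' : ContDiffAt ℝ (⊤ : ℕ∞) (deriv y) x := 
        hy.derivWithin (m := (⊤ : ℕ∞)) (by simp)
      have hev : deriv (g ∘ y) =ᶠ[𝓝 x] (deriv g ∘ y) * deriv y := by
        filter_upwards [(hy.of_le (m := 1) (by exact_mod_cast le_top)).eventually (by simp)]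
          with z hz
        exact deriv_comp z (hg.differentiable (by simp) _) (hz.differentiableAt (by simp))
      have hm : ((m : ℝ) + 1) ≠ 0 := by positivity
      apply mul_right_cancel₀ hm
      rw [← coeff_derivative, ← coeff_derivative, derivative_taylorPowerSeries,
        taylorPowerSeries_congr hev, taylorPowerSeries_mul (hg'.contDiffAt.comp x hy) hy',
        derivative_subst hus, derivative_taylorPowerSeries, coeff_mul, coeff_mul]
      refine Finset.sum_congr rfl fun p hp => ?_
      have := Finset.HasAntidiagonal.mem_antidiagonal.mp hp
      rw [ih p.1 (by lia) hg', hu, map_sub, derivative_C, sub_zero, derivative_taylorPowerSeries]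

/-- A power series solving the formal equation `u' = F ∘ u`, `u(0) = 0` is unique. -/
lemma PowerSeries.eq_of_derivative_eq_subst {F u v : PowerSeries ℝ} (hu0 : constantCoeff u = 0)
    (hv0 : constantCoeff v = 0) (hu : derivative ℝ u = F.subst u)
    (hv : derivative ℝ v = F.subst v) : u = v := by
  ext m
  induction m using Nat.strong_induction_on with
  | _ m ih =>
    rcases m with _ | m
    · simp [hu0, hv0]
    · have hm : ((m : ℝ) + 1) ≠ 0 := by positivity
      apply mul_right_cancel₀ hm
      rw [← coeff_derivative, ← coeff_derivative, hu, hv,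
        coeff_subst' (HasSubst.of_constantCoeff_zero' hu0),
        coeff_subst' (HasSubst.of_constantCoeff_zero' hv0)]
      have hdvd : (X : PowerSeries ℝ) ^ (m + 1) ∣ u - v :=
        X_pow_dvd_iff.mpr fun i hi => by rw [map_sub, ih i hi, sub_self]
      refine finsum_congr fun d => ?_
      have := X_pow_dvd_iff.mp (hdvd.trans (sub_dvd_pow_sub_pow u v d)) m (by lia)
      rw [map_sub, sub_eq_zero] at this
      rw [this]

end TaylorPowerSeries

lemma contDiffOn_of_hasDerivAt_comp {f y : ℝ → ℝ} {s : Set ℝ} (hs : IsOpen s)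
    (hf : ContDiff ℝ (⊤ : ℕ∞) f) (hy : ∀ h ∈ s, HasDerivAt y (f (y h)) h) :
    ContDiffOn ℝ (⊤ : ℕ∞) y s := by
  have hd : DifferentiableOn ℝ y s := fun h hh => (hy h hh).differentiableAt.differentiableWithinAt
  refine contDiffOn_infty.mpr fun n => ?_
  induction n with
  | zero => exact contDiffOn_zero.mpr hd.continuousOn
  | succ n ih =>
    push_cast
    rw [contDiffOn_succ_iff_deriv_of_isOpen hs]
    refine ⟨hd, by simp, ?_⟩
    exact ((hf.of_le (by exact_mod_cast le_top)).comp_contDiffOn ih).congr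
      fun h hh => (hy h hh).deriv

section MultiIndexSeries

open PowerSeries

lemma populated_iff (β : MI) : Populated β ↔ len β = (β.sum fun k n => k * n) + 1 := by
  have h : (β.sum fun k n => (1 - (k : ℤ)) * n) =
      (len β : ℤ) - ((β.sum fun k n => k * n : ℕ) : ℤ) := by
    simp only [len, Finsupp.sum, sub_mul, one_mul, Finset.sum_sub_distrib]
    push_cast
    rfl
  rw [Populated, h]
  lia

lemma Populated.one_le_len {β : MI} (h : Populated β) : 1 ≤ len β := by
  have := (populated_iff β).mp h
  lia

lemma len_corolla {k : ℕ} (βs : Fin k → MI) :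
    len (Finsupp.single k 1 + ∑ i, βs i) = 1 + ∑ i, len (βs i) := by
  have h : len (∑ i, βs i) = ∑ i, len (βs i) :=
    (Finsupp.sum_finsetSum_index (fun _ => rfl) fun _ _ _ => rfl).symm
  rw [← h, len, Finsupp.sum_add_index' (fun _ => rfl) fun _ _ _ => rfl,
    Finsupp.sum_single_index rfl, len]

lemma populated_corolla {k : ℕ} {βs : Fin k → MI} (h : ∀ i, Populated (βs i)) :
    Populated (Finsupp.single k 1 + ∑ i, βs i) := by
  rw [populated_iff, len_corolla, Finsupp.sum_add_index' (by simp) (fun _ _ _ => by ring),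
    Finsupp.sum_single_index (by simp),
    ← Finsupp.sum_finsetSum_index (by simp) (fun _ _ _ => by ring),
    Finset.sum_congr rfl fun i _ => (populated_iff (βs i)).mp (h i), Finset.sum_add_distrib]
  simp
  ring

/-- The finite set of populated multi-indices of length at most `n`. -/
noncomputable def populatedLE (n : ℕ) : Finset MI :=
  ((Finset.range (n + 1)).finsupp fun _ => Finset.range (n + 1)).filter
    fun β => Populated β ∧ len β ≤ n

lemma mem_populatedLE {n : ℕ} {β : MI} : β ∈ populatedLE n ↔ Populated β ∧ len β ≤ n := by
  refine ⟨fun h => (Finset.mem_filter.mp h).2, fun h => Finset.mem_filter.mpr ⟨?_, h⟩⟩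
  have hle : ∀ k ∈ β.support, β k ≤ n ∧ k ≤ n := by
    intro k hk
    have h1 : β k ≤ len β := Finset.single_le_sum (f := fun k => β k) (by simp) hk
    have h2 : k * β k ≤ β.sum fun k n => k * n :=
      Finset.single_le_sum (f := fun k => k * β k) (by simp) hk
    have h3 : k ≤ k * β k := Nat.le_mul_of_pos_right k (Nat.pos_of_ne_zero (by simpa using hk))
    have h4 := (populated_iff β).mp h.1
    have h5 := h.2
    constructor <;> lia
  refine Finset.mem_finsupp_iff.mpr ⟨fun k hk => ?_, fun k _ => ?_⟩
  · exact Finset.mem_range.mpr (Nat.lt_succ_of_le (hle k hk).2)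
  · by_cases hk : k ∈ β.support
    · exact Finset.mem_range.mpr (Nat.lt_succ_of_le (hle k hk).1)
    · simp [Finsupp.notMem_support_iff.mp hk]

/-- The monomial `∏_k φ(k)^{β(k)}`. -/
noncomputable def multiIndexMonomial (φ : ℕ → ℝ) (β : MI) : ℝ := β.prod fun k m => φ k ^ m

lemma multiIndexMonomial_corolla (φ : ℕ → ℝ) {k : ℕ} (βs : Fin k → MI) :
    multiIndexMonomial φ (Finsupp.single k 1 + ∑ i, βs i) =
      φ k * ∏ i, multiIndexMonomial φ (βs i) := by
  simp only [multiIndexMonomial]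
  rw [Finsupp.prod_add_index' (by simp) (fun _ _ _ => pow_add _ _ _),
    Finsupp.prod_single_index (by simp), pow_one,
    ← Finsupp.prod_finsetSum_index (by simp) (fun _ _ _ => pow_add _ _ _)]

/-- The B-series with coefficient map `a`: its degree `n` coefficient sums over the populated
multi-indices of length `n`. -/
noncomputable def multiIndexSeries (a : MI → ℝ) (φ : ℕ → ℝ) : PowerSeries ℝ :=
  PowerSeries.mk fun n =>
    ∑ β ∈ populatedLE n, if len β = n then a β * multiIndexMonomial φ β else 0

lemma coeff_multiIndexSeries (a : MI → ℝ) (φ : ℕ → ℝ) {m n : ℕ} (h : m ≤ n) :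
    coeff m (multiIndexSeries a φ) =
      ∑ β ∈ populatedLE n, if len β = m then a β * multiIndexMonomial φ β else 0 := by
  rw [multiIndexSeries, coeff_mk]
  refine Finset.sum_subset (fun β hβ => ?_) fun β hβ hβ' => if_neg fun hl => hβ' ?_
  · rw [mem_populatedLE] at hβ ⊢
    exact ⟨hβ.1, hβ.2.trans h⟩
  · exact mem_populatedLE.mpr ⟨(mem_populatedLE.mp hβ).1, hl.le⟩

lemma constantCoeff_multiIndexSeries (a : MI → ℝ) (φ : ℕ → ℝ) :
    constantCoeff (multiIndexSeries a φ) = 0 := by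
  rw [← coeff_zero_eq_constantCoeff_apply, coeff_multiIndexSeries a φ le_rfl]
  refine Finset.sum_eq_zero fun β hβ => if_neg ?_
  have := (mem_populatedLE.mp hβ).1.one_le_len
  lia

lemma coeff_multiIndexSeries_pow (a : MI → ℝ) (φ : ℕ → ℝ) (n k : ℕ) :
    coeff n (multiIndexSeries a φ ^ k) =
      ∑ βs ∈ Fintype.piFinset fun _ : Fin k => populatedLE n,
        if ∑ i, len (βs i) = n then ∏ i, (a (βs i) * multiIndexMonomial φ (βs i)) else 0 := by
  set p : PowerSeries ℝ :=
    ∑ β ∈ populatedLE n, C (a β * multiIndexMonomial φ β) * X ^ len β with hp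
  have hdvd : (X : PowerSeries ℝ) ^ (n + 1) ∣ multiIndexSeries a φ - p := by
    refine X_pow_dvd_iff.mpr fun m hm => ?_
    rw [map_sub, coeff_multiIndexSeries a φ (Nat.lt_succ_iff.mp hm), hp, map_sum, sub_eq_zero]
    refine Finset.sum_congr rfl fun β _ => ?_
    rw [coeff_C_mul, coeff_X_pow, mul_ite, mul_one, mul_zero]
    simp only [eq_comm]
  have h := X_pow_dvd_iff.mp (hdvd.trans (sub_dvd_pow_sub_pow _ p k)) n (Nat.lt_succ_self n)
  rw [map_sub, sub_eq_zero] at h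
  rw [h, hp, Finset.sum_pow', map_sum]
  refine Finset.sum_congr rfl fun βs _ => ?_
  rw [Finset.prod_mul_distrib, Finset.prod_pow_eq_pow_sum, ← map_prod, coeff_C_mul, coeff_X_pow]
  simp [eq_comm]

lemma finsum_corolla_eq_sum (a : MI → ℝ) {n : ℕ} {β : MI} (hβ : len β = n + 1) :
    (∑ᶠ k : ℕ, ∑ᶠ βs : Fin k → MI,
        if (∀ i, Populated (βs i)) ∧ Finsupp.single k 1 + ∑ i, βs i = β then
          ∏ i, a (βs i) else 0) =
      ∑ k ∈ Finset.range (n + 1), ∑ βs ∈ Fintype.piFinset fun _ : Fin k => populatedLE n,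
        if Finsupp.single k 1 + ∑ i, βs i = β then ∏ i, a (βs i) else 0 := by
  have key : ∀ (k : ℕ) (βs : Fin k → MI), (∀ i, Populated (βs i)) →
      Finsupp.single k 1 + ∑ i, βs i = β →
      k ≤ n ∧ βs ∈ Fintype.piFinset fun _ : Fin k => populatedLE n := by
    intro k βs hpop hsum
    have hlen : ∑ i, len (βs i) = n := by
      have := len_corolla βs
      rw [hsum, hβ] at this
      lia
    refine ⟨?_, Fintype.mem_piFinset.mpr fun i => mem_populatedLE.mpr ⟨hpop i, ?_⟩⟩
    · calc k = ∑ _i : Fin k, 1 := by simp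
        _ ≤ ∑ i, len (βs i) := Finset.sum_le_sum fun i _ => (hpop i).one_le_len
        _ = n := hlen
    · exact (Finset.single_le_sum (f := fun i => len (βs i)) (by simp)
        (Finset.mem_univ i)).trans hlen.le
  rw [finsum_eq_sum_of_support_subset (s := Finset.range (n + 1))]
  · refine Finset.sum_congr rfl fun k _ => ?_
    rw [finsum_eq_sum_of_support_subset (s := Fintype.piFinset fun _ : Fin k => populatedLE n)]
    · refine Finset.sum_congr rfl fun βs hβs => ?_
      have hpop : ∀ i, Populated (βs i) := fun i =>
        (mem_populatedLE.mp (Fintype.mem_piFinset.mp hβs i)).1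
      simp only [hpop, implies_true, true_and]
    · intro βs hβs
      have hc := (ite_ne_right_iff.mp (Function.mem_support.mp hβs)).1
      exact (key k βs hc.1 hc.2).2
  · intro k hk
    obtain ⟨βs, hβs⟩ := not_forall.mp fun h0 =>
      Function.mem_support.mp hk ((finsum_congr h0).trans finsum_zero)
    have hc := (ite_ne_right_iff.mp hβs).1
    simpa [Nat.lt_succ_iff] using (key k βs hc.1 hc.2).1

/-- The corolla recursion says that the multi-index series solves the formal ODE. -/
lemma derivative_multiIndexSeries {a : MI → ℝ} (φ : ℕ → ℝ)
    (ha : ∀ β, Populated β → (len β : ℝ) * a β =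
      ∑ᶠ k : ℕ, ∑ᶠ βs : Fin k → MI,
        if (∀ i, Populated (βs i)) ∧ Finsupp.single k 1 + ∑ i, βs i = β then
          ∏ i, a (βs i) else 0) :
    derivative ℝ (multiIndexSeries a φ) = (PowerSeries.mk φ).subst (multiIndexSeries a φ) := by
  ext n
  have hc0 := constantCoeff_multiIndexSeries a φ
  have hlow : ∀ k, n < k → coeff n (multiIndexSeries a φ ^ k) = 0 := fun k hk =>
    X_pow_dvd_iff.mp (pow_dvd_pow_of_dvd (X_dvd_iff.mpr hc0) k) n hk
  rw [coeff_subst' (HasSubst.of_constantCoeff_zero' hc0),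
    finsum_eq_sum_of_support_subset (s := Finset.range (n + 1)), coeff_derivative,
    coeff_multiIndexSeries a φ le_rfl, Finset.sum_mul]
  · have hβ : ∀ β ∈ populatedLE (n + 1),
        (if len β = n + 1 then a β * multiIndexMonomial φ β else 0) * ((n : ℝ) + 1) =
        ∑ k ∈ Finset.range (n + 1), ∑ βs ∈ Fintype.piFinset fun _ : Fin k => populatedLE n,
          if Finsupp.single k 1 + ∑ i, βs i = β then
            if ∑ i, len (βs i) = n then
              φ k * ∏ i, (a (βs i) * multiIndexMonomial φ (βs i)) else 0
          else 0 := by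
      intro β hβ
      by_cases hl : len β = n + 1
      · have h := ha β (mem_populatedLE.mp hβ).1
        rw [finsum_corolla_eq_sum a hl, hl] at h
        push_cast at h
        rw [if_pos hl, mul_right_comm, mul_comm (a β), h, Finset.sum_mul]
        refine Finset.sum_congr rfl fun k _ => ?_
        rw [Finset.sum_mul]
        refine Finset.sum_congr rfl fun βs _ => ?_
        split_ifs with h1 h2
        · rw [← h1, multiIndexMonomial_corolla, Finset.prod_mul_distrib]
          ring
        · rw [← h1, len_corolla] at hl
          lia
        · rw [zero_mul]
      · rw [if_neg hl, zero_mul]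
        refine (Finset.sum_eq_zero fun k _ => Finset.sum_eq_zero fun βs _ => ?_).symm
        split_ifs with h1 h2
        · rw [← h1, len_corolla] at hl
          lia
        · rfl
        · rfl
    rw [Finset.sum_congr rfl hβ, Finset.sum_comm]
    refine Finset.sum_congr rfl fun k _ => ?_
    rw [Finset.sum_comm, coeff_mk, coeff_multiIndexSeries_pow, smul_eq_mul, Finset.mul_sum]
    refine Finset.sum_congr rfl fun βs hβs => ?_
    rw [Finset.sum_ite_eq, mul_ite, mul_zero]
    by_cases hl : ∑ i, len (βs i) = n
    · refine if_pos (mem_populatedLE.mpr ⟨populated_corolla fun i =>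
        (mem_populatedLE.mp (Fintype.mem_piFinset.mp hβs i)).1, ?_⟩)
      rw [len_corolla]
      lia
    · simp [hl]
  · intro k hk
    by_contra hk'
    refine hk ?_
    dsimp only
    rw [hlow k (by simpa using hk'), smul_zero]

end MultiIndexSeries

/-- The exact solution of the one-dimensional ODE `y' = f(y)`, `y(0) = y₀`, is given by
a multi-indice B-series: the `n`-th derivative of `y` at `0` equals
`n! ∑_{β populated, |β| = n} (a(β)/S(β)) ∏_k (f^{(k)}(y₀))^{β(k)}` where `a` satisfies
the corolla recursion. -/
theorem exact_solution_is_multiindice_Bseries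
    (f : ℝ → ℝ) (hf : ContDiff ℝ (⊤ : ℕ∞) f) (y0 : ℝ) (ε : ℝ) (hε : 0 < ε)
    (y : ℝ → ℝ) (hy0 : y 0 = y0)
    (hy : ∀ h ∈ Set.Ioo (-ε) ε, HasDerivAt y (f (y h)) h)
    (a : MI → ℝ)
    (ha : ∀ β, Populated β → (len β : ℝ) * a β =
      ∑ᶠ k : ℕ, ∑ᶠ βs : Fin k → MI,
        if (∀ i, Populated (βs i)) ∧ Finsupp.single k 1 + ∑ i, βs i = β then
          ∏ i, a (βs i) else 0)
    (n : ℕ) (hn : 1 ≤ n) :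
    iteratedDeriv n y 0 = (n.factorial : ℝ) *
      ∑ᶠ β : MI, if Populated β ∧ len β = n then
        a β / S β * (β.prod fun k m => (iteratedDeriv k f y0) ^ m) else 0 := by
  subst hy0
  have hmem : Set.Ioo (-ε) ε ∈ nhds (0 : ℝ) := Ioo_mem_nhds (by linarith) hε
  have hyc : ContDiffAt ℝ (⊤ : ℕ∞) y 0 :=
    (contDiffOn_of_hasDerivAt_comp isOpen_Ioo hf hy).contDiffAt hmem
  have hev : deriv y =ᶠ[nhds 0] f ∘ y := by
    filter_upwards [hmem] with h hh using (hy h hh).deriv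
  set φ : ℕ → ℝ := fun k => iteratedDeriv k f (y 0) / (k.factorial : ℝ) with hφ
  have hseries : taylorPowerSeries y 0 - PowerSeries.C (y 0) = multiIndexSeries a φ := by
    refine PowerSeries.eq_of_derivative_eq_subst (F := taylorPowerSeries f (y 0)) ?_
      (constantCoeff_multiIndexSeries a φ) ?_ (derivative_multiIndexSeries φ ha)
    · rw [← PowerSeries.coeff_zero_eq_constantCoeff_apply, map_sub, coeff_taylorPowerSeries]
      simp
    · rw [map_sub, PowerSeries.derivative_C, sub_zero, derivative_taylorPowerSeries,
        taylorPowerSeries_congr hev, taylorPowerSeries_comp hyc hf]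
  have hcoeff := congrArg (PowerSeries.coeff n) hseries
  rw [map_sub, coeff_taylorPowerSeries, PowerSeries.coeff_C, if_neg (by lia), sub_zero,
    coeff_multiIndexSeries a φ le_rfl] at hcoeff
  have hfac : (n.factorial : ℝ) ≠ 0 := by positivity
  rw [(div_eq_iff hfac).mp hcoeff, mul_comm,
    finsum_eq_sum_of_support_subset (s := populatedLE n)]
  · congr 1
    refine Finset.sum_congr rfl fun β hβ => ?_
    simp only [(mem_populatedLE.mp hβ).1, true_and]
    refine if_congr Iff.rfl ?_ rfl
    rw [div_mul_eq_mul_div, mul_div_assoc, multiIndexMonomial, S, Finsupp.prod, Finsupp.prod,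
      Finsupp.prod, ← Finset.prod_div_distrib]
    simp only [hφ, div_pow]
  · intro β hβ
    have hc := (ite_ne_right_iff.mp (Function.mem_support.mp hβ)).1
    exact mem_populatedLE.mpr ⟨hc.1, hc.2.le⟩
end

section
/- Morphism property of elementary differentials with respect to the Grossman–Larson-type product ⋆₂: let f : ℝ → ℝ be C^∞, let n ∈ ℕ, let β_1, …, β_n and α be populated multi-indices, and let y ∈ ℝ. Then F_f[(∏_{j=1}^{n} z^{β_j}) · D^n(z^α)](y) = (∏_{j=1}^{n} F_f[z^{β_j}](y)) · (the n-th derivative at y of the function u ↦ F_f[z^α](u)), where the function u ↦ F_f[z^α](u) is C^∞ and D^n is the n-fold iterate of D. -/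
open MvPolynomial

/-- The monomial `z^β = ∏_k X_k^{β k}` in `ℝ[X_0, X_1, …]`. -/
noncomputable def zm (β : MI) : MvPolynomial ℕ ℝ := monomial β 1

/-- The derivation `D` with `D X_k = X_{k+1}`. -/
noncomputable def Dop (p : MvPolynomial ℕ ℝ) : MvPolynomial ℕ ℝ :=
  ∑ᶠ k : ℕ, X (k + 1) * pderiv k p

/-- The elementary differential `F_f[p](y)`: evaluate `p` at `X_k ↦ f^{(k)}(y)`. -/
noncomputable def Ff (f : ℝ → ℝ) (p : MvPolynomial ℕ ℝ) (y : ℝ) : ℝ :=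
  eval (fun k => iteratedDeriv k f y) p

lemma pderiv_support_finite (p : MvPolynomial ℕ ℝ) :
    (Function.support fun k : ℕ => X (k + 1) * pderiv k p).Finite := by
  refine p.vars.finite_toSet.subset fun k hk => ?_
  by_contra h
  exact hk (by simp [pderiv_eq_zero_of_notMem_vars (by simpa using h)])

lemma Dop_C (a : ℝ) : Dop (C a) = 0 := by
  simp [Dop]

lemma Dop_add (p q : MvPolynomial ℕ ℝ) : Dop (p + q) = Dop p + Dop q := by
  unfold Dop
  rw [← finsum_add_distrib (pderiv_support_finite p) (pderiv_support_finite q)]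
  simp only [map_add, mul_add]

lemma Dop_mul_X (p : MvPolynomial ℕ ℝ) (i : ℕ) :
    Dop (p * X i) = p * X (i + 1) + X i * Dop p := by
  have hX : ∑ᶠ k : ℕ, X (k + 1) * pderiv k (X i : MvPolynomial ℕ ℝ) = X (i + 1) := by
    rw [finsum_eq_single _ i fun k hk => by simp [pderiv_X_of_ne hk.symm]]
    simp
  unfold Dop
  rw [← hX, mul_finsum, mul_finsum, ← finsum_add_distrib]
  · refine finsum_congr fun k => ?_
    simp only [Derivation.leibniz, smul_eq_mul]
    ring
  · exact (pderiv_support_finite (X i)).subset fun k hk => right_ne_zero_of_mul hk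
  · exact (pderiv_support_finite p).subset fun k hk => right_ne_zero_of_mul hk

lemma Ff_C (f : ℝ → ℝ) (a : ℝ) : Ff f (C a) = fun _ => a := by
  ext u
  simp [Ff]

lemma Ff_X (f : ℝ → ℝ) (i : ℕ) : Ff f (X i) = iteratedDeriv i f := by
  ext u
  simp [Ff]

lemma Ff_add (f : ℝ → ℝ) (p q : MvPolynomial ℕ ℝ) : Ff f (p + q) = Ff f p + Ff f q := by
  ext u
  simp [Ff]

lemma Ff_mul (f : ℝ → ℝ) (p q : MvPolynomial ℕ ℝ) : Ff f (p * q) = Ff f p * Ff f q := by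
  ext u
  simp [Ff]

lemma hasDerivAt_Ff {f : ℝ → ℝ} (hf : ContDiff ℝ (⊤ : ℕ∞) f) (p : MvPolynomial ℕ ℝ) (y : ℝ) :
    HasDerivAt (Ff f p) (Ff f (Dop p) y) y := by
  induction p using MvPolynomial.induction_on with
  | C a =>
    rw [Dop_C, ← C_0, Ff_C, Ff_C]
    exact hasDerivAt_const y a
  | add p q hp hq =>
    rw [Dop_add, Ff_add, Ff_add]
    exact hp.add hq
  | mul_X p i hp =>
    have hi : HasDerivAt (iteratedDeriv i f) (iteratedDeriv (i + 1) f y) y := by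
      rw [iteratedDeriv_succ]
      exact (hf.differentiable_iteratedDeriv i (mod_cast WithTop.coe_lt_top _) y).hasDerivAt
    simp only [Dop_mul_X, Ff_add, Ff_mul, Ff_X]
    refine (hp.mul hi).congr_deriv ?_
    simp only [Pi.add_apply, Pi.mul_apply]
    ring

lemma iteratedDeriv_Ff {f : ℝ → ℝ} (hf : ContDiff ℝ (⊤ : ℕ∞) f) (n : ℕ)
    (p : MvPolynomial ℕ ℝ) : iteratedDeriv n (Ff f p) = Ff f (Dop^[n] p) := by
  induction n generalizing p with
  | zero => simp
  | succ n ih =>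
    rw [iteratedDeriv_succ', funext fun u => (hasDerivAt_Ff hf p u).deriv,
      Function.iterate_succ_apply]
    exact ih _

/-- Morphism property of elementary differentials with respect to the
Grossman–Larson-type product `⋆₂`:
`F_f[(∏_j z^{β_j}) · D^n(z^α)](y) = (∏_j F_f[z^{β_j}](y)) · (F_f[z^α])^{(n)}(y)`. -/
theorem elementary_differential_morphism_star2
    (f : ℝ → ℝ) (hf : ContDiff ℝ (⊤ : ℕ∞) f) (n : ℕ) (βs : Fin n → MI) (α : MI)
    (hβ : ∀ j, Populated (βs j)) (hα : Populated α) (y : ℝ) :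
    Ff f ((∏ j, zm (βs j)) * Dop^[n] (zm α)) y
      = (∏ j, Ff f (zm (βs j)) y) * iteratedDeriv n (fun u => Ff f (zm α) u) y := by
  rw [show (fun u => Ff f (zm α) u) = Ff f (zm α) from rfl, iteratedDeriv_Ff hf]
  simp only [Ff, map_mul, map_prod]
end

section
/- The simultaneous insertion commutes with the derivation D: for every n ∈ ℕ, all populated multi-indices β_1, …, β_n, every polynomial p ∈ ℝ[X_0, X_1, …], and every m ∈ ℕ, one has (β_1, …, β_n) ⋆₁ (D^m p) = D^m((β_1, …, β_n) ⋆₁ p). -/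
open MvPolynomial

/-- Iterated partial derivatives `∂_{X_{k_1}} ⋯ ∂_{X_{k_n}}`. -/
noncomputable def pderivs : {n : ℕ} → (Fin n → ℕ) → MvPolynomial ℕ ℝ → MvPolynomial ℕ ℝ
  | 0, _, p => p
  | _ + 1, k, p => pderivs (k ∘ Fin.succ) (pderiv (k 0) p)

/-- The simultaneous insertion `(β_1, …, β_n) ⋆₁ p`. -/
noncomputable def insert1 {n : ℕ} (βs : Fin n → MI) (p : MvPolynomial ℕ ℝ) :
    MvPolynomial ℕ ℝ :=
  ∑ᶠ k : Fin n → ℕ, (∏ j, Dop^[k j] (zm (βs j))) * pderivs k p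

/-- The derivation `D` as a bundled derivation of `ℝ[X_0, X_1, …]`. -/
noncomputable def shiftDerivation : Derivation ℝ (MvPolynomial ℕ ℝ) (MvPolynomial ℕ ℝ) :=
  mkDerivation ℝ fun k => X (k + 1)

theorem support_pderiv_finite (p : MvPolynomial ℕ ℝ) :
    (Function.support fun k => pderiv k p).Finite := by
  refine p.vars.finite_toSet.subset fun k hk => ?_
  by_contra h
  exact hk (pderiv_eq_zero_of_notMem_vars (by simpa using h))

theorem Dop_eq_shiftDerivation (p : MvPolynomial ℕ ℝ) : Dop p = shiftDerivation p := by
  have hsum : Dop p = ∑ k ∈ p.vars, X (k + 1) * pderiv k p := by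
    refine finsum_eq_sum_of_support_subset _ fun k hk => ?_
    by_contra h
    exact hk (by simp [pderiv_eq_zero_of_notMem_vars (show k ∉ p.vars by simpa using h)])
  obtain ⟨E, hE⟩ : ∃ E : Derivation ℝ (MvPolynomial ℕ ℝ) (MvPolynomial ℕ ℝ),
      ∀ q, E q = ∑ k ∈ p.vars, X (k + 1) * pderiv k q := by
    induction p.vars using Finset.induction_on with
    | empty => exact ⟨0, fun q => by simp⟩
    | insert a s ha ih =>
      obtain ⟨E, hE⟩ := ih
      refine ⟨(X (a + 1) : MvPolynomial ℕ ℝ) • pderiv a + E, fun q => ?_⟩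
      rw [Finset.sum_insert ha, Derivation.add_apply, Derivation.smul_apply, smul_eq_mul, hE]
  rw [hsum, ← hE]
  refine derivation_eq_of_forall_mem_vars fun i hi => ?_
  rw [hE, shiftDerivation, mkDerivation_X]
  rw [Finset.sum_eq_single i]
  · rw [pderiv_X_self, mul_one]
  · intro j _ hj
    rw [pderiv_X_of_ne hj.symm, mul_zero]
  · exact fun h => (h hi).elim

theorem pderiv_zero_Dop (p : MvPolynomial ℕ ℝ) : pderiv 0 (Dop p) = Dop (pderiv 0 p) := by
  have h : ⁅pderiv (R := ℝ) 0, shiftDerivation⁆ = 0 := by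
    refine derivation_ext fun i => ?_
    by_cases hi : i = 0 <;>
      simp [Derivation.commutator_apply, shiftDerivation, mkDerivation_X, pderiv_X, hi]
  have := congrArg (fun d => d p) h
  simpa [Derivation.commutator_apply, sub_eq_zero, Dop_eq_shiftDerivation] using this

theorem pderiv_succ_Dop (k : ℕ) (p : MvPolynomial ℕ ℝ) :
    pderiv (k + 1) (Dop p) = Dop (pderiv (k + 1) p) + pderiv k p := by
  have h : ⁅pderiv (R := ℝ) (k + 1), shiftDerivation⁆ = pderiv k := by
    refine derivation_ext fun i => ?_
    by_cases hi : i = k + 1 <;>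
      simp [Derivation.commutator_apply, shiftDerivation, mkDerivation_X, pderiv_X,
        Pi.single_apply, hi, apply_ite]
  have := congrArg (fun d => d p) h
  simp only [Derivation.commutator_apply, sub_eq_iff_eq_add] at this
  rw [Dop_eq_shiftDerivation, Dop_eq_shiftDerivation, this, add_comm]

theorem pderivs_zero {n : ℕ} (k : Fin n → ℕ) : pderivs k 0 = 0 := by
  induction n with
  | zero => rfl
  | succ n ih => simp [pderivs, ih]

theorem pderivs_add {n : ℕ} (k : Fin n → ℕ) (p q : MvPolynomial ℕ ℝ) :
    pderivs k (p + q) = pderivs k p + pderivs k q := by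
  induction n generalizing p q with
  | zero => rfl
  | succ n ih => simp [pderivs, ih]

theorem support_pderivs_finite {n : ℕ} (p : MvPolynomial ℕ ℝ) :
    (Function.support fun k : Fin n → ℕ => pderivs k p).Finite := by
  induction n generalizing p with
  | zero => exact Set.toFinite _
  | succ n ih =>
    refine ((support_pderiv_finite p).biUnion fun a _ =>
      (ih (pderiv a p)).image (Fin.cons (α := fun _ => ℕ) a)).subset fun k hk => ?_
    have hk' : pderivs (k ∘ Fin.succ) (pderiv (k 0) p) ≠ 0 := hk
    refine Set.mem_biUnion (x := k 0) (fun h => hk' ?_) ⟨k ∘ Fin.succ, hk', Fin.cons_self_tail k⟩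
    rw [show pderiv (k 0) p = 0 from h, pderivs_zero]

/-- Simultaneous insertion of arbitrary polynomials `g_1, …, g_n` into `p`. -/
noncomputable def insertPoly {n : ℕ} (g : Fin n → MvPolynomial ℕ ℝ) (p : MvPolynomial ℕ ℝ) :
    MvPolynomial ℕ ℝ :=
  ∑ᶠ k : Fin n → ℕ, (∏ j, Dop^[k j] (g j)) * pderivs k p

theorem support_insertPoly_finite {n : ℕ} (g : Fin n → MvPolynomial ℕ ℝ)
    (p : MvPolynomial ℕ ℝ) :
    (Function.support fun k : Fin n → ℕ => (∏ j, Dop^[k j] (g j)) * pderivs k p).Finite :=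
  (support_pderivs_finite p).subset (Function.support_mul_subset_right _ _)

theorem insertPoly_zero {n : ℕ} (g : Fin n → MvPolynomial ℕ ℝ) : insertPoly g 0 = 0 := by
  simp [insertPoly, pderivs_zero]

theorem insertPoly_add {n : ℕ} (g : Fin n → MvPolynomial ℕ ℝ) (p q : MvPolynomial ℕ ℝ) :
    insertPoly g (p + q) = insertPoly g p + insertPoly g q := by
  simp only [insertPoly, pderivs_add, mul_add]
  exact finsum_add_distrib (support_insertPoly_finite g p) (support_insertPoly_finite g q)

theorem insertPoly_succ {n : ℕ} (g : Fin (n + 1) → MvPolynomial ℕ ℝ) (p : MvPolynomial ℕ ℝ) :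
    insertPoly g p =
      ∑ᶠ a : ℕ, Dop^[a] (g 0) * insertPoly (fun j => g j.succ) (pderiv a p) := by
  rw [insertPoly, ← finsum_comp_equiv (Fin.consEquiv fun _ : Fin (n + 1) => ℕ), finsum_curry]
  · refine finsum_congr fun a => ?_
    rw [insertPoly, mul_finsum]
    refine finsum_congr fun t => ?_
    simp only [Fin.consEquiv_apply, Fin.prod_univ_succ, Fin.cons_zero, Fin.cons_succ, pderivs,
      mul_assoc]
    rfl
  · exact (support_insertPoly_finite g p).preimage (Equiv.injective _).injOn

theorem exists_forall_pderiv_eq_zero (p : MvPolynomial ℕ ℝ) :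
    ∃ N, ∀ k, N ≤ k → pderiv k p = 0 := by
  obtain ⟨N, hN⟩ := (support_pderiv_finite p).bddAbove
  exact ⟨N + 1, fun k hk => by_contra fun h => absurd (hN h) (by omega)⟩

theorem insertPoly_succ_eq_sum_range {n N : ℕ} (g : Fin (n + 1) → MvPolynomial ℕ ℝ)
    {p : MvPolynomial ℕ ℝ} (hN : ∀ k, N ≤ k → pderiv k p = 0) :
    insertPoly g p = ∑ a ∈ Finset.range N,
      Dop^[a] (g 0) * insertPoly (fun j => g j.succ) (pderiv a p) := by
  rw [insertPoly_succ]
  refine finsum_eq_sum_of_support_subset _ fun k hk => ?_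
  by_contra h
  exact hk (by simp [hN k (by simpa using h), insertPoly_zero])

theorem insertPoly_Dop {n : ℕ} (g : Fin n → MvPolynomial ℕ ℝ) (p : MvPolynomial ℕ ℝ) :
    insertPoly g (Dop p) = Dop (insertPoly g p) := by
  induction n generalizing p with
  | zero => simp [insertPoly, pderivs, finsum_unique]
  | succ n ih =>
    obtain ⟨N, hN⟩ := exists_forall_pderiv_eq_zero p
    have hD0 : Dop 0 = 0 := by simp [Dop_eq_shiftDerivation]
    have hDN : ∀ k, N + 1 ≤ k → pderiv k (Dop p) = 0 := by
      rintro (_ | k) hk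
      · omega
      · rw [pderiv_succ_Dop, hN _ (by omega), hN _ (by omega), hD0, add_zero]
    rw [insertPoly_succ_eq_sum_range g hDN, insertPoly_succ_eq_sum_range g hN,
      Dop_eq_shiftDerivation (∑ _ ∈ _, _), map_sum, Finset.sum_range_succ']
    simp only [Derivation.leibniz, smul_eq_mul, ← Dop_eq_shiftDerivation, pderiv_succ_Dop,
      pderiv_zero_Dop, insertPoly_add, ih, mul_add, Finset.sum_add_distrib,
      ← Function.iterate_succ_apply' Dop]
    have key := (Finset.sum_range_succ' (fun a =>
      Dop^[a] (g 0) * Dop (insertPoly (fun j => g j.succ) (pderiv a p))) N).symm.trans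
      (Finset.sum_range_succ _ N)
    simp only [hN N le_rfl, insertPoly_zero, hD0, mul_zero, add_zero] at key
    rw [add_right_comm, key]
    congr 1
    exact Finset.sum_congr rfl fun _ _ => mul_comm _ _

/-- The simultaneous insertion commutes with the derivation `D`. -/
theorem insert1_comm_Dop (n : ℕ) (βs : Fin n → MI) (hβ : ∀ j, Populated (βs j))
    (p : MvPolynomial ℕ ℝ) (m : ℕ) :
    insert1 βs (Dop^[m] p) = Dop^[m] (insert1 βs p) := by
  have h : Function.Semiconj (insert1 βs) Dop Dop := insertPoly_Dop fun j => zm (βs j)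
  exact h.iterate_right m p
end

section
/- For every populated multi-indice β there exists a rooted tree t with cnt(t) = β; that is, for each k ∈ ℕ the number of vertices of t with exactly k children equals β(k). -/
/-- Rooted trees: a tree is a (possibly empty) list of subtrees. -/
inductive T : Type
  | node : List T → T

/-- The arity count of a tree: `cnt t k` is the number of vertices of `t`
with exactly `k` children. `cnt (node [t_1, …, t_n]) = δ_n + cnt t_1 + ⋯ + cnt t_n`. -/
noncomputable def cnt : T → MI
  | .node l => Finsupp.single l.length 1 + (l.attach.map fun s => cnt s.1).sum
termination_by t => sizeOf t
decreasing_by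
  have := List.sizeOf_lt_of_mem s.2
  simp only [T.node.sizeOf_spec]
  omega

theorem cnt_node (l : List T) :
    cnt (.node l) = Finsupp.single l.length 1 + (l.map cnt).sum := by
  rw [cnt, List.attach_map_val (f := cnt)]

/-- The weight `∑_k (1 - k) β(k)` of a multi-indice. -/
def weight (β : MI) : ℤ := β.sum fun k n => (1 - (k : ℤ)) * n

theorem weight_add (β γ : MI) : weight (β + γ) = weight β + weight γ :=
  Finsupp.sum_add_index' (by simp) (by intros; push_cast; ring)

theorem weight_single (k n : ℕ) : weight (Finsupp.single k n) = (1 - (k : ℤ)) * n :=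
  Finsupp.sum_single_index (by simp)

/-- Every multi-indice of positive weight `m` is the arity count of a forest of `m` trees.
If some arity `k ≥ 1` occurs, remove it once and join `k` trees of the larger forest so obtained
under a new root. -/
theorem exists_forest_of_weight_pos (β : MI) {m : ℕ} (hm : 0 < m) (hβ : weight β = m) :
    ∃ l : List T, l.length = m ∧ (l.map cnt).sum = β := by
  induction hn : β.degree generalizing β m with
  | zero =>
    obtain rfl : β = 0 := (Finsupp.degree_eq_zero_iff β).1 hn
    simp [weight] at hβ
    omega
  | succ n ih =>
    by_cases h : ∃ k, 0 < k ∧ β k ≠ 0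
    · obtain ⟨k, hk, hβk⟩ := h
      obtain ⟨γ, rfl⟩ : ∃ γ, β = Finsupp.single k 1 + γ :=
        exists_add_of_le (Finsupp.single_le_iff.2 (Nat.one_le_iff_ne_zero.2 hβk))
      rw [weight_add, weight_single] at hβ
      rw [map_add, Finsupp.degree_single] at hn
      obtain ⟨l, hl, rfl⟩ := ih γ (m := m + k - 1) (by omega) (by push_cast at hβ; omega) (by omega)
      refine ⟨.node (l.take k) :: l.drop k, by simp; omega, ?_⟩
      have hlen : (l.take k).length = k := by simp; omega
      rw [List.map_cons, List.sum_cons, cnt_node, hlen, add_assoc, ← List.sum_append,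
        ← List.map_append, List.take_append_drop]
    · push Not at h
      obtain ⟨a, rfl⟩ : ∃ a, β = Finsupp.single 0 a := by
        refine ⟨β 0, ?_⟩
        ext k
        rcases Nat.eq_zero_or_pos k with rfl | hk
        · simp
        · simp [h k hk, hk.ne]
      rw [weight_single] at hβ
      obtain rfl : a = m := by push_cast at hβ; omega
      exact ⟨List.replicate a (.node []), by simp, by simp [cnt_node]⟩

/-- For every populated multi-indice `β` there exists a rooted tree `t` whose
arity count is `β`. -/
theorem exists_tree_of_populated (β : MI) (hβ : Populated β) :
    ∃ t : T, cnt t = β := by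
  obtain ⟨l, hl, rfl⟩ := exists_forest_of_weight_pos β one_pos (by exact_mod_cast hβ)
  obtain ⟨t, rfl⟩ := List.length_eq_one_iff.1 hl
  exact ⟨t, by simp⟩
end
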